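/- arXiv:1809.09288 — 4 statements merged into one kernel-verified Lean document; each statement's English description precedes it below -/
import Mathlib

section
/- For every positive integer k, every graph G in the class 𝒢_2(k), and every optimal independent broadcast f on G, one has max{f(x) : x ∈ V(G)} = 4k + 2. -/
open scoped Classical

variable {V : Type*}

/-- The eccentricity of a vertex `x` in a finite graph `G`. -/
noncomputable def graphEcc [Fintype V] (G : SimpleGraph V) (x : V) : ℕ :=
  Finset.univ.sup fun y => G.dist x y

/-- The diameter of a finite graph `G`. -/
noncomputable def graphDiam [Fintype V] (G : SimpleGraph V) : ℕ :=
  Finset.univ.sup fun p : V × V => G.dist p.1 p.2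

/-- `f` is an independent broadcast on `G`: (B1) `f x` is at most the eccentricity of `x`,
and (B2) any two distinct vertices with positive values are at distance larger than both values. -/
def IsIndepBroadcast [Fintype V] (G : SimpleGraph V) (f : V → ℕ) : Prop :=
  (∀ x, f x ≤ graphEcc G x) ∧
  (∀ x y, x ≠ y → 0 < f x → 0 < f y → max (f x) (f y) < G.dist x y)

/-- The broadcast independence number of `G`: the maximum weight of an independent broadcast. -/
noncomputable def broadcastIndepNum [Fintype V] (G : SimpleGraph V) : ℕ :=
  sSup {w | ∃ f : V → ℕ, IsIndepBroadcast G f ∧ ∑ x, f x = w}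

/-- The independence number of `G`: the maximum size of a set of pairwise nonadjacent vertices. -/
noncomputable def indepNum [Fintype V] (G : SimpleGraph V) : ℕ :=
  sSup {n | ∃ S : Finset V, (∀ x ∈ S, ∀ y ∈ S, x ≠ y → ¬ G.Adj x y) ∧ S.card = n}

/-- The induced subgraph of `G` on `S` is a `k`-strip with partition `(B 0, …, B k)`. -/
def IsStripIn (G : SimpleGraph V) (S : Set V) (k : ℕ) (B : ℕ → Set V) : Prop :=
  (∀ i ≤ k, (B i).Nonempty ∧ B i ⊆ S) ∧
  (∀ i ≤ k, ∀ j ≤ k, i ≠ j → Disjoint (B i) (B j)) ∧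
  (S = ⋃ i ∈ Set.Iic k, B i) ∧
  (∀ i ≤ k, ∀ u ∈ B i, ∀ v ∈ B i, u ≠ v → G.Adj u v) ∧
  (∃ x, B 0 = {x}) ∧
  (∀ x, B 0 = {x} → ∀ i ≤ k, ∀ y, y ∈ B i → ∀ (hx : x ∈ S) (hy : y ∈ S),
      (G.induce S).dist ⟨x, hx⟩ ⟨y, hy⟩ = i) ∧
  (∀ i < k, Even i → ∀ u ∈ B i, ∀ v ∈ B (i + 1), G.Adj u v)

/-- `G` belongs to the class `𝒢₂(k)`: it is a connected graph arising from the disjoint union of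
two `(2k+1)`-strips by adding some edges between the two last cliques. -/
def MemG2 (G : SimpleGraph V) (k : ℕ) : Prop :=
  G.Connected ∧
  ∃ (S₁ S₂ : Set V) (B₁ B₂ : ℕ → Set V),
    Disjoint S₁ S₂ ∧ S₁ ∪ S₂ = Set.univ ∧
    IsStripIn G S₁ (2 * k + 1) B₁ ∧ IsStripIn G S₂ (2 * k + 1) B₂ ∧
    (∀ u v, G.Adj u v → (u ∈ S₁ ∧ v ∈ S₁) ∨ (u ∈ S₂ ∧ v ∈ S₂) ∨
      (u ∈ B₁ (2 * k + 1) ∧ v ∈ B₂ (2 * k + 1)) ∨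
      (u ∈ B₂ (2 * k + 1) ∧ v ∈ B₁ (2 * k + 1)))

/-- `G` arises from the disjoint union of `ℓ` `2k`-strips (on the sets `S j`, with partitions
`B j`) and a possibly empty set `R` of vertices, by adding all possible edges within
`R ∪ ⋃ j, B j (2k)`. -/
def MemG0With (G : SimpleGraph V) (k : ℕ) {ℓ : ℕ} (S : Fin ℓ → Set V)
    (B : Fin ℓ → ℕ → Set V) (R : Set V) : Prop :=
  (R ∪ ⋃ j, S j) = Set.univ ∧
  (∀ j, Disjoint R (S j)) ∧
  (Pairwise fun j j' => Disjoint (S j) (S j')) ∧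
  (∀ j, IsStripIn G (S j) (2 * k) (B j)) ∧
  (∀ u v, u ≠ v → u ∈ R ∪ ⋃ j, B j (2 * k) → v ∈ R ∪ ⋃ j, B j (2 * k) → G.Adj u v) ∧
  (∀ u v, G.Adj u v → (∃ j, u ∈ S j ∧ v ∈ S j) ∨
      ((u ∈ R ∪ ⋃ j, B j (2 * k)) ∧ (v ∈ R ∪ ⋃ j, B j (2 * k))))

/-- `G` belongs to the class `𝒢₀(k, ℓ)`. -/
def MemG0 (G : SimpleGraph V) (k ℓ : ℕ) : Prop :=
  ∃ (S : Fin ℓ → Set V) (B : Fin ℓ → ℕ → Set V) (R : Set V), MemG0With G k S B R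

lemma aux_sum {V : Type*} (f : V → ℕ) (c : V → ℤ) (L : ℤ) (S : Finset V) :
    ∀ p : V, L ≤ c p → (∀ u ∈ S, L ≤ c u) → (∀ u ∈ S, (f u : ℤ) ≤ 2 * (c p - c u)) →
    (∀ u ∈ S, ∀ v ∈ S, u ≠ v → (f u : ℤ) ≤ 2 * |c u - c v|) →
    ((∑ u ∈ S, f u : ℕ) : ℤ) ≤ 2 * (c p - L) := by
  classical
  induction S using Finset.induction_on_max_value c with
  | empty => intro p hp _ _ _; simp; exact hp
  | insert q T hq hmax ih =>
    intro p hp hL hfp hpair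
    have h1 := ih q (hL q (by simp)) (fun u hu => hL u (by simp [hu])) (by
      intro u hu
      have := hpair u (by simp [hu]) q (by simp) (by rintro rfl; exact hq hu)
      have h2 := hmax u hu
      rw [abs_of_nonpos (by omega)] at this
      omega) (fun u hu v hv => hpair u (by simp [hu]) v (by simp [hv]))
    have h2 := hfp q (by simp)
    rw [Finset.sum_insert hq]
    push_cast at *
    linarith

lemma aux_three {V : Type*} (f : V → ℕ) (c : V → ℤ) (N : ℤ) (S : Finset V)
    (hc0 : ∀ u, 0 ≤ c u) (hcN : ∀ u, c u ≤ N)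
    (hpair : ∀ u ∈ S, ∀ v ∈ S, u ≠ v → (f u : ℤ) ≤ 2 * |c u - c v|)
    (hcard : 3 ≤ S.card) : ((∑ u ∈ S, f u : ℕ) : ℤ) ≤ 3 * N := by
  classical
  have hne : S.Nonempty := Finset.card_pos.mp (by omega)
  obtain ⟨b, hb, hbm⟩ := S.exists_max_image c hne
  obtain ⟨a, ha, ham⟩ := S.exists_min_image c hne
  obtain ⟨e, he, hea, heb⟩ : ∃ e ∈ S, e ≠ a ∧ e ≠ b := by
    by_contra! hcon
    have : S ⊆ {a, b} := by
      intro e he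
      by_cases h : e = a
      · simp [h]
      · simp [hcon e he h]
    have h1 := Finset.card_le_card this
    have h2 := Finset.card_le_two (a := a) (b := b)
    omega
  have hab := ham b hb
  have ha0 := hc0 a
  have hbN := hcN b
  have fb := hpair b hb e he heb.symm
  have fa := hpair a ha e he hea.symm
  rw [abs_of_nonneg (by have := hbm e he; omega)] at fb
  rw [abs_of_nonpos (by have := ham e he; omega)] at fa
  have s1 := aux_sum f c (c a) (S.erase b) b hab (fun u hu => ham u (Finset.mem_of_mem_erase hu))
    (by
      intro u hu
      have hu' := Finset.mem_of_mem_erase hu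
      have := hpair u hu' b hb (Finset.ne_of_mem_erase hu)
      rw [abs_of_nonpos (by have := hbm u hu'; omega)] at this
      omega)
    (fun u hu v hv => hpair u (Finset.mem_of_mem_erase hu) v (Finset.mem_of_mem_erase hv))
  have s2 := aux_sum f (fun v => - c v) (- c b) (S.erase a) a (by simpa using hab)
    (fun u hu => by simpa using hbm u (Finset.mem_of_mem_erase hu))
    (by
      intro u hu
      have hu' := Finset.mem_of_mem_erase hu
      have := hpair u hu' a ha (Finset.ne_of_mem_erase hu)
      rw [abs_of_nonneg (by have := ham u hu'; omega)] at this
      omega)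
    (fun u hu v hv h => by
      have := hpair u (Finset.mem_of_mem_erase hu) v (Finset.mem_of_mem_erase hv) h
      rw [abs_sub_comm] at this
      have e : - c u - - c v = c v - c u := by ring
      rw [e]; exact this)
  have t1 := Finset.sum_erase_add S f hb
  have t2 := Finset.sum_erase_add S f ha
  omega

lemma strip_mem {G : SimpleGraph V} {S : Set V} {K : ℕ} {B : ℕ → Set V}
    (h : IsStripIn G S K B) {y : V} (hy : y ∈ S) : ∃ i ≤ K, y ∈ B i := by
  rw [h.2.2.1] at hy
  simpa using hy

lemma strip_sub {G : SimpleGraph V} {S : Set V} {K : ℕ} {B : ℕ → Set V}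
    (h : IsStripIn G S K B) {i : ℕ} (hi : i ≤ K) {y : V} (hy : y ∈ B i) : y ∈ S :=
  (h.1 i hi).2 hy

lemma strip_down {G : SimpleGraph V} {S : Set V} {K : ℕ} {B : ℕ → Set V}
    (h : IsStripIn G S K B) {i : ℕ} (hi : i + 1 ≤ K) {y : V} (hy : y ∈ B (i + 1)) :
    ∃ z ∈ B i, G.Adj z y := by
  have h' := h
  obtain ⟨h1, h2, h3, h4, ⟨x, hx⟩, h6, h7⟩ := h
  have hxS : x ∈ S := (h1 0 (by omega)).2 (by simp [hx])
  have hyS : y ∈ S := (h1 _ hi).2 hy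
  have hd := h6 x hx (i+1) hi y hy hxS hyS
  have hr : (G.induce S).Reachable ⟨x, hxS⟩ ⟨y, hyS⟩ := by
    by_contra hcon
    rw [SimpleGraph.dist_eq_zero_of_not_reachable hcon] at hd
    omega
  obtain ⟨p, hp⟩ := hr.symm.exists_walk_length_eq_dist
  rw [SimpleGraph.dist_comm, hd] at hp
  cases p with
  | nil => simp at hp
  | @cons _ z _ hadj q =>
    simp at hp
    obtain ⟨j, hj, hzj⟩ := strip_mem h' z.2
    have hdz := h6 x hx j hj z.1 hzj hxS z.2
    have hle : (G.induce S).dist ⟨x, hxS⟩ z ≤ i := by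
      rw [SimpleGraph.dist_comm, ← hp]; exact SimpleGraph.dist_le q
    have hdz' : (G.induce S).dist ⟨x, hxS⟩ z = j := hdz
    have hge : i + 1 ≤ j + 1 := by
      rw [← hd, ← hdz']
      have hrz : (G.induce S).Reachable ⟨x, hxS⟩ z := ⟨q.reverse⟩
      obtain ⟨r, hr⟩ := hrz.exists_walk_length_eq_dist
      rw [← hr]
      have := SimpleGraph.dist_le (r.concat hadj.symm)
      simpa using this
    have : j = i := by omega
    subst this
    exact ⟨z.1, hzj, by simpa using hadj.symm⟩

lemma strip_adj {G : SimpleGraph V} {S : Set V} {K : ℕ} {B : ℕ → Set V}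
    (h : IsStripIn G S K B) {i j : ℕ} (hi : i ≤ K) (hj : j ≤ K) {u v : V} (hu : u ∈ B i)
    (hv : v ∈ B j) (ha : G.Adj u v) : j ≤ i + 1 := by
  rcases j with _ | j
  · omega
  have h' := h
  obtain ⟨h1, h2, h3, h4, ⟨x, hx⟩, h6, h7⟩ := h
  have hxS : x ∈ S := (h1 0 (by omega)).2 (by simp [hx])
  have huS : u ∈ S := (h1 _ hi).2 hu
  have hvS : v ∈ S := (h1 _ hj).2 hv
  have hd := h6 x hx _ hj v hv hxS hvS
  have hd' := h6 x hx _ hi u hu hxS huS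
  have hr : (G.induce S).Reachable ⟨x, hxS⟩ ⟨v, hvS⟩ := by
    by_contra hcon
    rw [SimpleGraph.dist_eq_zero_of_not_reachable hcon] at hd
    omega
  have hadj : (G.induce S).Adj ⟨v, hvS⟩ ⟨u, huS⟩ := by simpa using ha.symm
  obtain ⟨r, hr⟩ := (hr.trans hadj.reachable).exists_walk_length_eq_dist
  have := SimpleGraph.dist_le (r.concat hadj.symm)
  simp at this
  omega

lemma strip_clique {G : SimpleGraph V} {S : Set V} {k : ℕ} {B : ℕ → Set V}
    (h : IsStripIn G S (2 * k + 1) B) {i j : ℕ} (hi : i ≤ 2 * k + 1) (hj : j ≤ 2 * k + 1)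
    {u v : V} (hu : u ∈ B i) (hv : v ∈ B j) (hij : i / 2 = j / 2) : G.dist u v ≤ 1 := by
  obtain ⟨h1, h2, h3, h4, h5, h6, h7⟩ := h
  by_cases huv : u = v
  · subst huv; simp
  have : G.Adj u v := by
    by_cases e : i = j
    · subst e; exact h4 i hi u hu v hv huv
    · rcases Nat.lt_or_gt_of_ne e with e | e
      · obtain rfl : j = i + 1 := by omega
        exact h7 i (by omega) (by rw [Nat.even_iff]; omega) u hu v hv
      · obtain rfl : i = j + 1 := by omega
        exact (h7 j (by omega) (by rw [Nat.even_iff]; omega) v hv u hu).symm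
  exact (SimpleGraph.dist_eq_one_iff_adj.mpr this).le

lemma strip_dist {G : SimpleGraph V} (hconn : G.Connected) {S : Set V} {k : ℕ} {B : ℕ → Set V}
    (h : IsStripIn G S (2 * k + 1) B) {a : ℕ} (ha : a ≤ 2 * k + 1) {x : V} (hx : x ∈ B a) (n : ℕ) :
    ∀ b ≤ 2 * k + 1, ∀ y ∈ B b, b / 2 = a / 2 + n → G.dist x y ≤ 2 * n + 1 := by
  induction n with
  | zero => intro b hb y hy hab; exact strip_clique h ha hb hx hy (by omega)
  | succ n ih =>
    intro b hb y hy hab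
    obtain ⟨b, rfl⟩ : ∃ b', b = b' + 1 := ⟨b - 1, by omega⟩
    obtain ⟨z, hz, hzy⟩ := strip_down h hb hy
    have e1 := SimpleGraph.dist_eq_one_iff_adj.mpr hzy
    have t1 := hconn.dist_triangle (u := x) (v := z) (w := y)
    by_cases hpar : b / 2 = a / 2 + n
    · have := ih b (by omega) z hz hpar
      omega
    · obtain ⟨b, rfl⟩ : ∃ b', b = b' + 1 := ⟨b - 1, by omega⟩
      obtain ⟨w, hw, hwz⟩ := strip_down h (by omega) hz
      have e2 := SimpleGraph.dist_eq_one_iff_adj.mpr hwz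
      have t2 := hconn.dist_triangle (u := x) (v := w) (w := z)
      have := ih b (by omega) w hw (by omega)
      omega

lemma strip_level {G : SimpleGraph V} {S : Set V} {K : ℕ} {B : ℕ → Set V}
    (h : IsStripIn G S K B) : ∃ l : V → ℕ, ∀ y ∈ S, l y ≤ K ∧ y ∈ B (l y) := by
  have : ∀ y, ∃ i, y ∈ S → i ≤ K ∧ y ∈ B i := by
    intro y
    by_cases hy : y ∈ S
    · obtain ⟨i, hi⟩ := strip_mem h hy
      exact ⟨i, fun _ => hi⟩
    · exact ⟨0, fun h => absurd h hy⟩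
  choose l hl using this
  exact ⟨l, hl⟩

lemma strip_uniq {G : SimpleGraph V} {S : Set V} {K : ℕ} {B : ℕ → Set V}
    (h : IsStripIn G S K B) {i j : ℕ} (hi : i ≤ K) (hj : j ≤ K) {y : V} (h1 : y ∈ B i)
    (h2 : y ∈ B j) : i = j := by
  by_contra hne
  exact Set.disjoint_left.mp (h.2.1 i hi j hj hne) h1 h2

lemma walk_pot {G : SimpleGraph V} (L : V → ℤ) (hL : ∀ u v, G.Adj u v → L v ≤ L u + 1)
    {u v : V} (p : G.Walk u v) : L v ≤ L u + p.length := by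
  induction p with
  | nil => simp
  | cons h q ih => have := hL _ _ h; simp; omega

lemma g2_struct {G : SimpleGraph V} {k : ℕ} (hG : MemG2 G k) :
    ∃ (x₁ x₂ : V) (c : V → ℤ), (∀ v, 0 ≤ c v ∧ c v ≤ 2 * k + 1) ∧
      (∀ u v, (G.dist u v : ℤ) ≤ 2 * |c u - c v| + 1) ∧ 4 * k + 3 ≤ G.dist x₁ x₂ := by
  obtain ⟨hconn, S₁, S₂, B₁, B₂, hdisj, hun, hs1, hs2, hadj⟩ := hG
  obtain ⟨l₁, hl₁⟩ := strip_level hs1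
  obtain ⟨l₂, hl₂⟩ := strip_level hs2
  obtain ⟨x₁, hx₁⟩ := hs1.2.2.2.2.1
  obtain ⟨x₂, hx₂⟩ := hs2.2.2.2.2.1
  have hx1 : x₁ ∈ B₁ 0 := by simp [hx₁]
  have hx2 : x₂ ∈ B₂ 0 := by simp [hx₂]
  have hx1S := strip_sub hs1 (by omega) hx1
  have hx2S := strip_sub hs2 (by omega) hx2
  have hnot : ∀ v, v ∈ S₁ → v ∈ S₂ → False := fun v h1 h2 => Set.disjoint_left.mp hdisj h1 h2
  have hor : ∀ v, v ∈ S₁ ∨ v ∈ S₂ := fun v => by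
    have : v ∈ S₁ ∪ S₂ := by rw [hun]; trivial
    exact this
  have hl1 : ∀ i ≤ 2 * k + 1, ∀ v ∈ B₁ i, l₁ v = i := fun i hi v hv => by
    have := hl₁ v (strip_sub hs1 hi hv)
    exact strip_uniq hs1 this.1 hi this.2 hv
  have hl2 : ∀ i ≤ 2 * k + 1, ∀ v ∈ B₂ i, l₂ v = i := fun i hi v hv => by
    have := hl₂ v (strip_sub hs2 hi hv)
    exact strip_uniq hs2 this.1 hi this.2 hv
  -- middle edge
  obtain ⟨p, q, hp, hq, hpq⟩ : ∃ p q, p ∈ B₁ (2 * k + 1) ∧ q ∈ B₂ (2 * k + 1) ∧ G.Adj p q := by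
    obtain ⟨w⟩ := hconn x₁ x₂
    obtain ⟨d, _, hd1, hd2⟩ := w.exists_boundary_dart S₁ hx1S (fun h => hnot _ h hx2S)
    rcases hadj _ _ d.adj with h | h | h | h
    · exact absurd h.2 hd2
    · exact (hnot _ hd1 h.1).elim
    · exact ⟨_, _, h.1, h.2, d.adj⟩
    · exact (hnot _ hd1 (strip_sub hs2 le_rfl h.1)).elim
  have hpq1 := SimpleGraph.dist_eq_one_iff_adj.mpr hpq
  -- level function
  let L : V → ℤ := fun v => if v ∈ S₁ then (l₁ v : ℤ) else 4 * k + 3 - l₂ v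
  have L1 : ∀ v ∈ S₁, L v = l₁ v := fun v hv => by simp [L, hv]
  have L2 : ∀ v ∈ S₂, L v = 4 * k + 3 - l₂ v := fun v hv => by
    have : v ∉ S₁ := fun h => hnot v h hv
    simp [L, this]
  have cross : ∀ u ∈ S₁, ∀ v ∈ S₂, (G.dist u v : ℤ) ≤ 2 * |L u / 2 - L v / 2| + 1 := by
    intro u hu v hv
    obtain ⟨a1, a2⟩ := hl₁ u hu
    obtain ⟨b1, b2⟩ := hl₂ v hv
    have d1 := strip_dist hconn hs1 a1 a2 (k - l₁ u / 2) (2 * k + 1) le_rfl p hp (by omega)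
    have d2 := strip_dist hconn hs2 b1 b2 (k - l₂ v / 2) (2 * k + 1) le_rfl q hq (by omega)
    have t1 := hconn.dist_triangle (u := u) (v := p) (w := v)
    have t2 := hconn.dist_triangle (u := p) (v := q) (w := v)
    rw [SimpleGraph.dist_comm] at d2
    rw [L1 u hu, L2 v hv, abs_of_nonpos (by omega)]
    omega
  refine ⟨x₁, x₂, fun v => L v / 2, ?_, ?_, ?_⟩
  · intro v
    rcases hor v with h | h
    · have := hl₁ v h
      simp only [L1 v h]; omega
    · have := hl₂ v h
      simp only [L2 v h]; omega
  · have same1 : ∀ u ∈ S₁, ∀ v ∈ S₁, l₁ u / 2 ≤ l₁ v / 2 →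
        (G.dist u v : ℤ) ≤ 2 * |L u / 2 - L v / 2| + 1 := by
      intro u hu v hv huv
      obtain ⟨a1, a2⟩ := hl₁ u hu
      obtain ⟨b1, b2⟩ := hl₁ v hv
      have d1 := strip_dist hconn hs1 a1 a2 (l₁ v / 2 - l₁ u / 2) _ b1 v b2 (by omega)
      rw [L1 u hu, L1 v hv, abs_of_nonpos (by omega)]
      omega
    have same2 : ∀ u ∈ S₂, ∀ v ∈ S₂, l₂ u / 2 ≤ l₂ v / 2 →
        (G.dist u v : ℤ) ≤ 2 * |L u / 2 - L v / 2| + 1 := by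
      intro u hu v hv huv
      obtain ⟨a1, a2⟩ := hl₂ u hu
      obtain ⟨b1, b2⟩ := hl₂ v hv
      have d1 := strip_dist hconn hs2 a1 a2 (l₂ v / 2 - l₂ u / 2) _ b1 v b2 (by omega)
      rw [L2 u hu, L2 v hv, abs_of_nonneg (by omega)]
      omega
    intro u v
    rcases hor u with hu | hu <;> rcases hor v with hv | hv
    · rcases le_total (l₁ u / 2) (l₁ v / 2) with h | h
      · exact same1 u hu v hv h
      · rw [SimpleGraph.dist_comm, abs_sub_comm]; exact same1 v hv u hu h
    · exact cross u hu v hv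
    · rw [SimpleGraph.dist_comm, abs_sub_comm]; exact cross v hv u hu
    · rcases le_total (l₂ u / 2) (l₂ v / 2) with h | h
      · exact same2 u hu v hv h
      · rw [SimpleGraph.dist_comm, abs_sub_comm]; exact same2 v hv u hu h
  · have hL : ∀ u v, G.Adj u v → L v ≤ L u + 1 := by
      intro u v huv
      rcases hadj u v huv with ⟨hu, hv⟩ | ⟨hu, hv⟩ | ⟨hu, hv⟩ | ⟨hu, hv⟩
      · have := strip_adj hs1 (hl₁ u hu).1 (hl₁ v hv).1 (hl₁ u hu).2 (hl₁ v hv).2 huv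
        rw [L1 u hu, L1 v hv]; omega
      · have := strip_adj hs2 (hl₂ v hv).1 (hl₂ u hu).1 (hl₂ v hv).2 (hl₂ u hu).2 huv.symm
        rw [L2 u hu, L2 v hv]; omega
      · rw [L1 u (strip_sub hs1 le_rfl hu), L2 v (strip_sub hs2 le_rfl hv),
          hl1 _ le_rfl u hu, hl2 _ le_rfl v hv]
        push_cast; omega
      · rw [L2 u (strip_sub hs2 le_rfl hu), L1 v (strip_sub hs1 le_rfl hv),
          hl2 _ le_rfl u hu, hl1 _ le_rfl v hv]
        push_cast; omega
    obtain ⟨w, hw⟩ := hconn.exists_walk_length_eq_dist x₁ x₂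
    have := walk_pot L hL w
    rw [L1 _ hx1S, L2 _ hx2S, hl1 0 (by omega) _ hx1, hl2 0 (by omega) _ hx2] at this
    omega

lemma le_bnum [Fintype V] {G : SimpleGraph V} {g : V → ℕ} (hg : IsIndepBroadcast G g) :
    ∑ x, g x ≤ broadcastIndepNum G := by
  apply le_csSup
  · refine ⟨∑ x, graphEcc G x, ?_⟩
    rintro w ⟨h, hh, rfl⟩
    exact Finset.sum_le_sum fun x _ => hh.1 x
  · exact ⟨g, hg, rfl⟩

/-- For every positive integer `k`, every `G ∈ 𝒢₂(k)`, and every optimal independent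
broadcast `f` on `G`, one has `max {f(x) : x ∈ V(G)} = 4k + 2`. -/
theorem stmt6 {V : Type*} [Fintype V] (G : SimpleGraph V) (k : ℕ) (hk : 1 ≤ k)
    (hG : MemG2 G k) (f : V → ℕ) (hf : IsIndepBroadcast G f)
    (hopt : ∑ x, f x = broadcastIndepNum G) :
    Finset.univ.sup f = 4 * k + 2 := by
  obtain ⟨x₁, x₂, c, hc, hd, hx⟩ := g2_struct hG
  have hne : x₁ ≠ x₂ := by rintro rfl; simp at hx
  have hlow : 8 * k + 4 ≤ ∑ x, f x := by
    rw [hopt]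
    have hg : IsIndepBroadcast G (fun v => if v ∈ ({x₁, x₂} : Finset V) then 4 * k + 2 else 0) := by
      constructor
      · intro x
        dsimp only
        split_ifs with h
        · simp at h
          rcases h with rfl | rfl
          · have : G.dist x x₂ ≤ graphEcc G x :=
              Finset.le_sup (f := fun y => G.dist x y) (Finset.mem_univ x₂)
            omega
          · have : G.dist x x₁ ≤ graphEcc G x :=
              Finset.le_sup (f := fun y => G.dist x y) (Finset.mem_univ x₁)
            rw [SimpleGraph.dist_comm] at this
            omega
        · omega
      · intro x y hxy h1 h2
        dsimp only at h1 h2 ⊢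
        split_ifs at h1 h2 ⊢ with hx' hy' <;> try omega
        simp at hx' hy'
        have hcm : G.dist x₂ x₁ = G.dist x₁ x₂ := SimpleGraph.dist_comm
        rcases hx' with rfl | rfl <;> rcases hy' with rfl | rfl
        · exact absurd rfl hxy
        · simp; omega
        · simp; omega
        · exact absurd rfl hxy
    refine le_trans ?_ (le_bnum hg)
    rw [Finset.sum_ite_mem, Finset.univ_inter, Finset.sum_pair hne]
    omega
  have hdiam : ∀ u v, G.dist u v ≤ 4 * k + 3 := by
    intro u v
    have h1 := hd u v
    have h2 : |c u - c v| ≤ 2 * k + 1 := by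
      have := hc u
      have := hc v
      rw [abs_le]; omega
    omega
  have hecc : ∀ v, f v ≤ 4 * k + 3 := fun v =>
    (hf.1 v).trans (Finset.sup_le fun y _ => hdiam v y)
  apply le_antisymm
  · apply Finset.sup_le
    intro v _
    by_contra! hv
    have hz : ∀ w, w ≠ v → f w = 0 := by
      intro w hw
      by_contra hw0
      have := hf.2 v w hw.symm (by omega) (by omega)
      have h2 := hdiam v w
      have h3 := le_max_left (f v) (f w)
      omega
    rw [Finset.sum_eq_single v (fun w _ hw => hz w hw) (by simp)] at hlow
    have := hecc v
    omega
  · by_contra! hlt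
    have hall : ∀ v, f v ≤ 4 * k + 1 := fun v => by
      have := Finset.le_sup (f := f) (Finset.mem_univ v)
      omega
    have hsum : ∑ x ∈ Finset.univ.filter (fun x => 0 < f x), f x = ∑ x, f x := by
      apply Finset.sum_subset (Finset.filter_subset _ _)
      intro x _ hx
      simp at hx
      exact hx
    rw [← hsum] at hlow
    by_cases hcard : 3 ≤ (Finset.univ.filter (fun x => 0 < f x)).card
    · have := aux_three f c (2 * k + 1) (Finset.univ.filter (fun x => 0 < f x))
        (fun u => (hc u).1) (fun u => (hc u).2) (by
          intro u hu v hv huv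
          simp only [Finset.mem_filter, Finset.mem_univ, true_and] at hu hv
          have h1 := hf.2 u v huv hu hv
          have h2 := hd u v
          have h3 := le_max_left (f u) (f v)
          omega) hcard
      omega
    · have h1 : ∑ x ∈ Finset.univ.filter (fun x => 0 < f x), f x ≤ _ := Finset.sum_le_card_nsmul (Finset.univ.filter (fun x => 0 < f x)) f (4 * k + 1)
        (fun x _ => hall x)
      rw [smul_eq_mul] at h1
      have h2 : (Finset.univ.filter (fun x => 0 < f x)).card ≤ 2 := by omega
      have := Nat.mul_le_mul_right (4 * k + 1) h2
      omega
end

section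
/- Let f be an independent broadcast on a connected graph G, and let X = {x ∈ V(G) : f(x) > 0}. If f(x) ≡ 1 (mod 4) or f(x) ≡ 2 (mod 4) for every x ∈ X, then 4α(G) ≥ Σ_{x∈X} (f(x) + 2); in particular, the weight of f is at most 4α(G) − 2|X|. -/
open scoped Classical

variable {V : Type*}

theorem aux_exists_dist (G : SimpleGraph V) (hG : G.Connected) (x y : V) (n : ℕ)
    (h : n ≤ G.dist x y) : ∃ z, G.dist x z = n := by
  obtain ⟨p, hp⟩ := hG.exists_walk_length_eq_dist x y
  refine ⟨p.getVert n, ?_⟩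
  have h1 := SimpleGraph.dist_le (p.take n)
  have h2 := SimpleGraph.dist_le (p.drop n)
  have h3 := hG.dist_triangle (u := x) (v := p.getVert n) (w := y)
  rw [SimpleGraph.Walk.take_length] at h1
  rw [SimpleGraph.Walk.drop_length] at h2
  omega

theorem aux_card_le [Fintype V] (G : SimpleGraph V) (S : Finset V)
    (h : ∀ x ∈ S, ∀ y ∈ S, x ≠ y → ¬ G.Adj x y) : S.card ≤ indepNum G := by
  apply le_csSup
  · refine ⟨Fintype.card V, ?_⟩
    rintro n ⟨T, -, rfl⟩
    exact Finset.card_le_univ T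
  · exact ⟨S, h, rfl⟩

/-- If `f` is an independent broadcast on a connected graph `G`,
`X = {x : f(x) > 0}`, and `f(x) ≡ 1` or `2 (mod 4)` for every `x ∈ X`, then
`4 α(G) ≥ Σ_{x ∈ X} (f(x) + 2)`; in particular the weight of `f` is at most `4 α(G) − 2|X|`. -/
theorem stmt13 {V : Type*} [Fintype V] (G : SimpleGraph V) (hG : G.Connected)
    (f : V → ℕ) (hf : IsIndepBroadcast G f)
    (hmod : ∀ x ∈ Finset.univ.filter fun x => 0 < f x, f x % 4 = 1 ∨ f x % 4 = 2) :
    (∑ x ∈ Finset.univ.filter (fun x => 0 < f x), (f x + 2)) ≤ 4 * indepNum G ∧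
      ∑ x, f x + 2 * (Finset.univ.filter fun x => 0 < f x).card ≤ 4 * indepNum G := by
  have key : (∑ x ∈ Finset.univ.filter (fun x => 0 < f x), (f x + 2)) ≤ 4 * indepNum G := by
    have hex : ∀ x : V, ∀ i : ℕ, ∃ z, i ≤ f x / 4 → G.dist x z = 2 * i := by
      intro x i
      by_cases hi : i ≤ f x / 4
      · have h1 := hf.1 x
        obtain ⟨y, -, hy⟩ := Finset.exists_mem_eq_sup (Finset.univ : Finset V) ⟨x, Finset.mem_univ x⟩
          (fun y => G.dist x y)
        have h2 : f x ≤ G.dist x y := by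
          rw [← hy]; exact h1
        obtain ⟨z, hz⟩ := aux_exists_dist G hG x y (2 * i) (by omega)
        exact ⟨z, fun _ => hz⟩
      · exact ⟨x, fun h => absurd h hi⟩
    choose p hp using hex
    have far : ∀ x y i j, 0 < f x → 0 < f y → i ≤ f x / 4 → j ≤ f y / 4 →
        (x ≠ y ∨ i ≠ j) → 2 ≤ G.dist (p x i) (p y j) := by
      intro x y i j hx hy hi hj hne
      have h1 := hp x i hi
      have h2 := hp y j hj
      by_cases hxy : x = y
      · subst hxy
        have t1 := hG.dist_triangle (u := x) (v := p x i) (w := p x j)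
        have t2 := hG.dist_triangle (u := x) (v := p x j) (w := p x i)
        rw [SimpleGraph.dist_comm (u := p x j)] at t2
        have : i ≠ j := by tauto
        omega
      · have h3 := hf.2 x y hxy hx hy
        have m1 := hmod x (by simpa using hx)
        have m2 := hmod y (by simpa using hy)
        have t1 := hG.dist_triangle (u := x) (v := p x i) (w := y)
        have t2 := hG.dist_triangle (u := p x i) (v := p y j) (w := y)
        rw [SimpleGraph.dist_comm (u := p y j)] at t2
        rw [max_lt_iff] at h3
        omega
    let T : Finset (Σ _ : V, ℕ) :=
      (Finset.univ.filter (fun x => 0 < f x)).sigma (fun x => Finset.range (f x / 4 + 1))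
    have hT : ∀ a ∈ T, 0 < f a.1 ∧ a.2 ≤ f a.1 / 4 := by
      intro a ha
      simp only [T, Finset.mem_sigma, Finset.mem_filter, Finset.mem_univ, true_and,
        Finset.mem_range] at ha
      exact ⟨ha.1, by omega⟩
    have farT : ∀ a ∈ T, ∀ b ∈ T, a ≠ b → 2 ≤ G.dist (p a.1 a.2) (p b.1 b.2) := by
      rintro ⟨x, i⟩ ha ⟨y, j⟩ hb hab
      refine far x y i j (hT _ ha).1 (hT _ hb).1 (hT _ ha).2 (hT _ hb).2 ?_
      by_contra hc
      push Not at hc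
      obtain ⟨rfl, rfl⟩ := hc
      exact hab rfl
    have hinj : Set.InjOn (fun a : (Σ _ : V, ℕ) => p a.1 a.2) (T : Set (Σ _ : V, ℕ)) := by
      intro a ha b hb hab
      by_contra hne
      have := farT a ha b hb hne
      simp only at hab
      rw [hab, SimpleGraph.dist_self] at this
      omega
    have hcard := aux_card_le G (T.image (fun a => p a.1 a.2)) (by
      intro u hu v hv huv hadj
      obtain ⟨a, ha, rfl⟩ := Finset.mem_image.1 hu
      obtain ⟨b, hb, rfl⟩ := Finset.mem_image.1 hv
      have := farT a ha b hb (fun h => huv (by rw [h]))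
      rw [SimpleGraph.dist_eq_one_iff_adj.2 hadj] at this
      omega)
    rw [Finset.card_image_of_injOn hinj, Finset.card_sigma] at hcard
    simp only [Finset.card_range] at hcard
    refine le_trans ?_ (Nat.mul_le_mul_left 4 hcard)
    rw [Finset.mul_sum]
    apply Finset.sum_le_sum
    intro x hx
    have := hmod x hx
    omega
  refine ⟨key, ?_⟩
  rw [Finset.sum_add_distrib, Finset.sum_const, smul_eq_mul] at key
  have : ∑ x ∈ Finset.univ.filter (fun x => 0 < f x), f x = ∑ x, f x := by
    apply Finset.sum_subset (Finset.filter_subset _ _)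
    intro x _ hx
    simpa using hx
  omega
end

section
/- Let f be an independent broadcast on a connected graph G, and let X = {x ∈ V(G) : f(x) > 0}. If no x ∈ X has f(x) ≡ 0 (mod 4) and some x ∈ X has f(x) ≡ 3 (mod 4), then 4α(G) ≥ 4 + Σ_{x∈X} (f(x) + 1); in particular, the weight of f is at most 4(α(G) − 1) − |X|. -/
open scoped Classical

variable {V : Type*}

theorem exists_dist_eq_aux [Fintype V] (G : SimpleGraph V) (hG : G.Connected) (x : V) (i : ℕ)
    (hi : i ≤ graphEcc G x) : ∃ y, G.dist x y = i := by
  obtain ⟨y, -, hy⟩ := Finset.exists_mem_eq_sup (Finset.univ : Finset V) ⟨x, Finset.mem_univ x⟩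
    (fun y => G.dist x y)
  have hy' : graphEcc G x = G.dist x y := hy
  obtain ⟨w, hw⟩ := hG.exists_walk_length_eq_dist x y
  have h1 := SimpleGraph.dist_le (w.take i)
  have h2 := SimpleGraph.dist_le (w.drop i)
  rw [SimpleGraph.Walk.take_length] at h1
  rw [SimpleGraph.Walk.drop_length] at h2
  have h3 := hG.dist_triangle (u := x) (v := w.getVert i) (w := y)
  exact ⟨w.getVert i, by omega⟩

/-- If `f` is an independent broadcast on a connected graph `G`,
`X = {x : f(x) > 0}`, no `x ∈ X` has `f(x) ≡ 0 (mod 4)`, and some `x ∈ X` has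
`f(x) ≡ 3 (mod 4)`, then `4 α(G) ≥ 4 + Σ_{x ∈ X} (f(x) + 1)`; in particular the weight of `f`
is at most `4 (α(G) − 1) − |X|`. -/
theorem stmt14 {V : Type*} [Fintype V] (G : SimpleGraph V) (hG : G.Connected)
    (f : V → ℕ) (hf : IsIndepBroadcast G f)
    (h0 : ∀ x ∈ Finset.univ.filter fun x => 0 < f x, f x % 4 ≠ 0)
    (h3 : ∃ x ∈ Finset.univ.filter fun x => 0 < f x, f x % 4 = 3) :
    4 + (∑ x ∈ Finset.univ.filter (fun x => 0 < f x), (f x + 1)) ≤ 4 * indepNum G ∧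
      ∑ x, f x + (Finset.univ.filter fun x => 0 < f x).card + 4 ≤ 4 * indepNum G := by
  obtain ⟨hB1, hB2⟩ := hf
  obtain ⟨x0, hx0, hx03⟩ := h3
  have hx0' : 0 < f x0 := by simpa using hx0
  set X := Finset.univ.filter (fun x => 0 < f x) with hX
  have hex : ∀ x i, ∃ y, i ≤ graphEcc G x → G.dist x y = i := by
    intro x i
    by_cases h : i ≤ graphEcc G x
    · obtain ⟨y, hy⟩ := exists_dist_eq_aux G hG x i h
      exact ⟨y, fun _ => hy⟩
    · exact ⟨x, fun h' => absurd h' h⟩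
  choose p hp using hex
  let K : V → ℕ := fun x => f x / 4 + 1 + (if x = x0 then 1 else 0)
  let T : Finset (Σ _ : V, ℕ) := X.sigma fun x => Finset.range (K x)
  have hpd : ∀ x ∈ X, ∀ i < K x, G.dist x (p x (2 * i)) = 2 * i := by
    intro x hx i hi
    apply hp
    have h1 := hB1 x
    have h2 := h0 x hx
    simp only [K] at hi
    split_ifs at hi with h
    · subst h; omega
    · omega
  have key : ∀ a ∈ T, ∀ b ∈ T, a ≠ b →
      2 ≤ G.dist (p a.1 (2 * a.2)) (p b.1 (2 * b.2)) := by
    rintro ⟨x, i⟩ ha ⟨y, j⟩ hb hab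
    simp only [T, Finset.mem_sigma, Finset.mem_range] at ha hb
    obtain ⟨hx, hi⟩ := ha
    obtain ⟨hy, hj⟩ := hb
    have e1 := hpd x hx i hi
    have e2 := hpd y hy j hj
    by_cases hxy : x = y
    · subst hxy
      have hij : i ≠ j := by rintro rfl; exact hab rfl
      have t1 := hG.dist_triangle (u := x) (v := p x (2 * i)) (w := p x (2 * j))
      have t2 := hG.dist_triangle (u := x) (v := p x (2 * j)) (w := p x (2 * i))
      rw [SimpleGraph.dist_comm (u := p x (2 * j)) (v := p x (2 * i))] at t2
      show 2 ≤ G.dist (p x (2 * i)) (p x (2 * j))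
      omega
    · have hx' : 0 < f x := by simpa [hX] using hx
      have hy' : 0 < f y := by simpa [hX] using hy
      have hd := hB2 x y hxy hx' hy'
      have m1 := (le_max_left (f x) (f y)).trans_lt hd
      have m2 := (le_max_right (f x) (f y)).trans_lt hd
      have t1 := hG.dist_triangle (u := x) (v := p x (2 * i)) (w := y)
      have t2 := hG.dist_triangle (u := p x (2 * i)) (v := p y (2 * j)) (w := y)
      rw [SimpleGraph.dist_comm (u := p y (2 * j)) (v := y)] at t2
      show 2 ≤ G.dist (p x (2 * i)) (p y (2 * j))
      have z1 := h0 x hx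
      have z2 := h0 y hy
      simp only [K] at hi hj
      split_ifs at hi hj with h h'
      · exact absurd (h.trans h'.symm) hxy
      · subst h; omega
      · rename_i h'
        subst h'; omega
      · omega
  have hinj : Set.InjOn (fun a : (Σ _ : V, ℕ) => p a.1 (2 * a.2)) T := by
    intro a ha b hb hab
    by_contra hne
    have := key a ha b hb hne
    simp only at hab
    rw [hab, SimpleGraph.dist_self] at this
    omega
  have hcard : (T.image fun a => p a.1 (2 * a.2)).card = ∑ x ∈ X, K x := by
    rw [Finset.card_image_of_injOn hinj]
    simp [T, Finset.card_sigma]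
  have hle : ∑ x ∈ X, K x ≤ indepNum G := by
    apply le_csSup
    · refine ⟨Fintype.card V, ?_⟩
      rintro n ⟨S, -, rfl⟩
      exact Finset.card_le_univ S
    · refine ⟨_, ?_, hcard⟩
      intro u hu v hv huv hadj
      obtain ⟨a, ha, rfl⟩ := Finset.mem_image.1 hu
      obtain ⟨b, hb, rfl⟩ := Finset.mem_image.1 hv
      have hab : a ≠ b := by rintro rfl; exact huv rfl
      have := key a ha b hb hab
      rw [SimpleGraph.dist_eq_one_iff_adj.2 hadj] at this
      omega
  have hsum : 4 + ∑ x ∈ X, (f x + 1) ≤ 4 * ∑ x ∈ X, K x := by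
    have e : ∑ x ∈ X, (f x + 1 + (if x = x0 then 4 else 0)) = ∑ x ∈ X, (f x + 1) + 4 := by
      rw [Finset.sum_add_distrib, Finset.sum_ite_eq' X x0, if_pos hx0]
    rw [add_comm, ← e, Finset.mul_sum]
    apply Finset.sum_le_sum
    intro x _
    simp only [K]
    split_ifs <;> omega
  have hw : ∑ x, f x = ∑ x ∈ X, f x := by
    symm
    apply Finset.sum_subset (Finset.subset_univ X)
    intro x _ hx
    simpa [hX] using hx
  have hs : ∑ x ∈ X, (f x + 1) = ∑ x ∈ X, f x + X.card := by
    rw [Finset.sum_add_distrib]; simp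
  constructor <;> omega
end

section
/- Let G be an graph in 𝒢_0(k,ℓ) for positive integers k and ℓ with ℓ ≥ 2, arising from 2k-strips H_1,…,H_ℓ with partitions (B_0^i,…,B_{2k}^i). For indices r and s with 0 ≤ r < s ≤ 2k and any j ∈ {1,…,ℓ}, the distance in G between any vertex in B_r^j and any vertex in B_s^j is at most s − r + 1, and at most s − r if r = 0. -/
open scoped Classical

variable {V : Type*}

theorem strip_step {V : Type*} (G : SimpleGraph V) (S : Set V) (K : ℕ) (B : ℕ → Set V)
    (h : IsStripIn G S K B) (i : ℕ) (hi : i + 1 ≤ K) (v : V) (hv : v ∈ B (i + 1)) :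
    ∃ w ∈ B i, G.Adj v w := by
  obtain ⟨h1, -, h3, -, ⟨x, hx⟩, h6, -⟩ := h
  have hxS : x ∈ S := (h1 0 (Nat.zero_le _)).2 (by rw [hx]; rfl)
  have hvS : v ∈ S := (h1 _ hi).2 hv
  have hd := h6 x hx (i + 1) hi v hv hxS hvS
  have hd' : (G.induce S).dist ⟨v, hvS⟩ ⟨x, hxS⟩ = i + 1 := by
    rw [SimpleGraph.dist_comm]; exact hd
  have hr : (G.induce S).Reachable ⟨v, hvS⟩ ⟨x, hxS⟩ :=
    SimpleGraph.Reachable.of_dist_ne_zero (by omega)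
  obtain ⟨p, hp⟩ := hr.exists_walk_length_eq_dist
  rw [hd'] at hp
  cases p with
  | nil => simp at hp
  | @cons _ w _ hadj q =>
    obtain ⟨w, hwS⟩ := w
    have hadj' : G.Adj v w := hadj
    have hw := hwS
    rw [h3] at hw
    simp only [Set.mem_iUnion, Set.mem_Iic] at hw
    obtain ⟨m, hm, hwm⟩ := hw
    have hdm := h6 x hx m hm w hwm hxS hwS
    rw [SimpleGraph.dist_comm] at hdm
    have hq : q.length = i := by simpa using hp
    have hle := SimpleGraph.dist_le q
    obtain ⟨q', hq'⟩ := q.reachable.exists_walk_length_eq_dist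
    have hle2 := SimpleGraph.dist_le (SimpleGraph.Walk.cons hadj q')
    rw [SimpleGraph.Walk.length_cons] at hle2
    have : m = i := by omega
    subst this
    exact ⟨w, hwm, hadj'⟩

theorem strip_walk {V : Type*} (G : SimpleGraph V) (S : Set V) (K : ℕ) (B : ℕ → Set V)
    (h : IsStripIn G S K B) (r n : ℕ) : r + n ≤ K → ∀ v ∈ B (r + n),
    ∃ w ∈ B r, ∃ p : G.Walk v w, p.length = n := by
  induction n with
  | zero => intro _ v hv; exact ⟨v, hv, SimpleGraph.Walk.nil, rfl⟩
  | succ n ih =>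
    intro hK v hv
    obtain ⟨w, hw, ha⟩ := strip_step G S K B h (r + n) hK v hv
    obtain ⟨z, hz, p, hp⟩ := ih (by omega) w hw
    exact ⟨z, hz, SimpleGraph.Walk.cons ha p, by simp [hp]⟩

/-- Let `G ∈ 𝒢₀(k, ℓ)` arise from `2k`-strips with partitions `B j` on the sets
`S j` and the set `R`. For `0 ≤ r < s ≤ 2k` and any `j`, the distance in `G` between any vertex
of `B j r` and any vertex of `B j s` is at most `s − r + 1`, and at most `s − r` if `r = 0`. -/
theorem stmt16 {V : Type*} [Fintype V] (G : SimpleGraph V) (k ℓ : ℕ) (hk : 1 ≤ k) (hℓ : 2 ≤ ℓ)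
    (S : Fin ℓ → Set V) (B : Fin ℓ → ℕ → Set V) (R : Set V) (hG : MemG0With G k S B R)
    (r s : ℕ) (hrs : r < s) (hs : s ≤ 2 * k) (j : Fin ℓ)
    (u v : V) (hu : u ∈ B j r) (hv : v ∈ B j s) :
    G.dist u v ≤ s - r + 1 ∧ (r = 0 → G.dist u v ≤ s - r) := by
  have h := hG.2.2.2.1 j
  obtain ⟨n, rfl⟩ := Nat.exists_eq_add_of_lt hrs
  obtain ⟨w, hw, p, hp⟩ := strip_walk G _ _ _ h r (n + 1) hs v hv
  have hwd : G.dist w v ≤ n + 1 := by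
    rw [SimpleGraph.dist_comm, ← hp]; exact SimpleGraph.dist_le p
  constructor
  · by_cases huw : u = w
    · subst huw; omega
    · have ha := h.2.2.2.1 r (by omega) u hu w hw huw
      have := SimpleGraph.dist_le (SimpleGraph.Walk.cons ha p.reverse)
      simp [hp] at this
      omega
  · rintro rfl
    obtain ⟨x, hx⟩ := h.2.2.2.2.1
    rw [hx] at hu hw
    obtain rfl : u = x := hu
    obtain rfl : w = u := hw
    omega
end
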